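/- For every θ ∈ [0,π], ∫₀^π ∫₀^π 1{θ < α+β < π}·2·F(α)·F_∞(β) dα dβ = F_∞(θ). (Equation (eq:Finftyintegral) of the paper, the criticality identity for the generating functions.) -/

import Mathlib

open MeasureTheory Real

noncomputable def J0 (x : ℝ) : ℝ :=
  ∑' k : ℕ, (-1 : ℝ) ^ k * (x / 2) ^ (2 * k) / ((Nat.factorial k : ℝ)) ^ 2

noncomputable def J1 (x : ℝ) : ℝ :=
  ∑' k : ℕ, (-1 : ℝ) ^ k * (x / 2) ^ (2 * k + 1) /
    ((Nat.factorial k : ℝ) * (Nat.factorial (k + 1) : ℝ))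

noncomputable def c0 : ℝ := sInf {x : ℝ | 0 < x ∧ J0 x = 0}

/-- `F_∞(θ) = J₀(θ c₀/π)`. -/
noncomputable def Finf (θ : ℝ) : ℝ := J0 (θ * c0 / Real.pi)

/-- The critical generating function `F(x_c; θ) = c₀ J₁(θ c₀/π)/(2πθ)`, with
`F(0) = (c₀/(2π))²`. -/
noncomputable def F (θ : ℝ) : ℝ :=
  if θ = 0 then (c0 / (2 * Real.pi)) ^ 2
  else c0 * J1 (θ * c0 / Real.pi) / (2 * Real.pi * θ)

/-- The even power series `∑ c k * x ^ (2 * k)`. -/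
noncomputable def evenSeries (c : ℕ → ℝ) (x : ℝ) : ℝ := ∑' k, c k * x ^ (2 * k)

lemma norm_term_le {c : ℕ → ℝ} (hc : ∀ k, |c k| ≤ 1 / (Nat.factorial k : ℝ)) {x R : ℝ}
    (hx : |x| ≤ R) (k : ℕ) : ‖c k * x ^ (2 * k)‖ ≤ (R ^ 2) ^ k / (Nat.factorial k : ℝ) := by
  rw [norm_mul, norm_pow, Real.norm_eq_abs, Real.norm_eq_abs, pow_mul]
  calc |c k| * (|x| ^ 2) ^ k ≤ 1 / (Nat.factorial k : ℝ) * (R ^ 2) ^ k := by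
        gcongr
        exact hc k
    _ = _ := by ring

lemma summable_norm_term {c : ℕ → ℝ} (hc : ∀ k, |c k| ≤ 1 / (Nat.factorial k : ℝ)) (x : ℝ) :
    Summable fun k => ‖c k * x ^ (2 * k)‖ :=
  Summable.of_nonneg_of_le (fun _ => norm_nonneg _) (fun k => norm_term_le hc le_rfl k)
    (Real.summable_pow_div_factorial _)

lemma hasSum_evenSeries {c : ℕ → ℝ} (hc : ∀ k, |c k| ≤ 1 / (Nat.factorial k : ℝ)) (x : ℝ) :
    HasSum (fun k => c k * x ^ (2 * k)) (evenSeries c x) :=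
  (summable_norm_term hc x).of_norm.hasSum

lemma hasSum_mul_evenSeries {c d : ℕ → ℝ} (hc : ∀ k, |c k| ≤ 1 / (Nat.factorial k : ℝ))
    (hd : ∀ k, |d k| ≤ 1 / (Nat.factorial k : ℝ)) (x y : ℝ) :
    HasSum (fun p : ℕ × ℕ => c p.1 * x ^ (2 * p.1) * (d p.2 * y ^ (2 * p.2)))
      (evenSeries c x * evenSeries d y) := by
  have h := summable_mul_of_summable_norm (f := fun k => c k * x ^ (2 * k))
    (g := fun k => d k * y ^ (2 * k)) (summable_norm_term hc x) (summable_norm_term hd y)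
  exact HasSum.mul (f := fun k => c k * x ^ (2 * k)) (g := fun k => d k * y ^ (2 * k))
    (hasSum_evenSeries hc x) (hasSum_evenSeries hd y) h

lemma continuous_evenSeries {c : ℕ → ℝ} (hc : ∀ k, |c k| ≤ 1 / (Nat.factorial k : ℝ)) :
    Continuous (evenSeries c) := by
  rw [continuous_iff_continuousAt]
  intro x
  have h : ContinuousOn (evenSeries c) (Set.Icc (-(|x| + 1)) (|x| + 1)) := by
    refine continuousOn_tsum (fun k => by fun_prop)
      (Real.summable_pow_div_factorial ((|x| + 1) ^ 2)) ?_
    intro k y hy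
    exact norm_term_le hc (abs_le.2 hy) k
  refine h.continuousAt (Icc_mem_nhds ?_ ?_)
  · linarith [neg_abs_le x]
  · linarith [le_abs_self x]

/-- The coefficients of `J₀`. -/
noncomputable def coeffJ0 (k : ℕ) : ℝ := (-1) ^ k / (4 ^ k * (Nat.factorial k : ℝ) ^ 2)

/-- The coefficients of `J₁(x) / x`. -/
noncomputable def coeffJ1 (k : ℕ) : ℝ :=
  (-1) ^ k / (2 * 4 ^ k * ((Nat.factorial k : ℝ) * (Nat.factorial (k + 1) : ℝ)))

lemma one_le_factorial (k : ℕ) : (1 : ℝ) ≤ Nat.factorial k := by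
  exact_mod_cast Nat.factorial_pos k

lemma abs_coeffJ0_le (k : ℕ) : |coeffJ0 k| ≤ 1 / (Nat.factorial k : ℝ) := by
  have h1 := one_le_factorial k
  have h2 : (1 : ℝ) ≤ 4 ^ k := one_le_pow₀ (by norm_num)
  rw [coeffJ0, abs_div, abs_pow, abs_neg, abs_one, one_pow, abs_of_pos (by positivity)]
  gcongr
  nlinarith [mul_le_mul h2 h1 (by norm_num) (by positivity)]

lemma abs_coeffJ1_le (k : ℕ) : |coeffJ1 k| ≤ 1 / (Nat.factorial k : ℝ) := by
  have h1 := one_le_factorial k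
  have h3 := one_le_factorial (k + 1)
  have h2 : (1 : ℝ) ≤ 4 ^ k := one_le_pow₀ (by norm_num)
  rw [coeffJ1, abs_div, abs_pow, abs_neg, abs_one, one_pow, abs_of_pos (by positivity)]
  gcongr
  calc (Nat.factorial k : ℝ) = 1 * (Nat.factorial k * 1) := by ring
    _ ≤ _ := by
      gcongr
      linarith

lemma J0_eq (x : ℝ) : J0 x = evenSeries coeffJ0 x := by
  refine tsum_congr fun k => ?_
  rw [coeffJ0, div_pow, pow_mul 2]
  norm_num
  field_simp

lemma J1_eq (x : ℝ) : J1 x = x * evenSeries coeffJ1 x := by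
  rw [evenSeries, ← tsum_mul_left]
  refine tsum_congr fun k => ?_
  rw [coeffJ1, div_pow, pow_succ 2, pow_mul 2]
  norm_num
  field_simp
  ring

lemma continuous_J0 : Continuous J0 := by
  rw [funext J0_eq]
  exact continuous_evenSeries abs_coeffJ0_le

lemma continuous_J1 : Continuous J1 := by
  rw [funext J1_eq]
  exact continuous_id.mul (continuous_evenSeries abs_coeffJ1_le)

lemma J0_zero : J0 0 = 1 := by
  rw [J0, tsum_eq_single 0]
  · simp
  · intro k hk
    simp [hk]

lemma J0_three_neg : J0 3 < 0 := by
  have hs := hasSum_evenSeries abs_coeffJ0_le 3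
  rw [← J0_eq] at hs
  have ht := (hasSum_nat_add_iff' 4).2 hs
  have hb : ∀ k : ℕ, ‖coeffJ0 (k + 4) * 3 ^ (2 * (k + 4))‖ ≤ 1 / 20 * (1 / 2 : ℝ) ^ k := by
    intro k
    have : ‖coeffJ0 (k + 4) * 3 ^ (2 * (k + 4))‖
        = 9 ^ (k + 4) / (4 ^ (k + 4) * (Nat.factorial (k + 4) : ℝ) ^ 2) := by
      rw [coeffJ0, norm_mul, norm_div, norm_pow, norm_neg, norm_one, one_pow,
        Real.norm_of_nonneg (by positivity), Real.norm_of_nonneg (by positivity), pow_mul]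
      norm_num
      ring
    rw [this, div_le_iff₀ (by positivity)]
    clear this
    induction k with
    | zero => norm_num [Nat.factorial]
    | succ k ih =>
      have hf : ((k + 1 + 4).factorial : ℝ) = (k + 5) * (k + 4).factorial := by
        rw [show k + 1 + 4 = (k + 4) + 1 by ring, Nat.factorial_succ]
        push_cast
        ring
      rw [hf]
      calc (9 : ℝ) ^ (k + 1 + 4) = 9 * 9 ^ (k + 4) := by ring
        _ ≤ 9 * (1 / 20 * (1 / 2) ^ k * (4 ^ (k + 4) * ((k + 4).factorial : ℝ) ^ 2)) := by gcongr
        _ = 9 / 2 * (1 / 20 * (1 / 2) ^ k * (4 * 4 ^ (k + 4) * ((k + 4).factorial : ℝ) ^ 2)) *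
            (1 / 2) := by ring
        _ ≤ (k + 5) ^ 2 * (1 / 20 * (1 / 2) ^ k *
            (4 * 4 ^ (k + 4) * ((k + 4).factorial : ℝ) ^ 2)) * (1 / 2) := by
          gcongr
          nlinarith [(Nat.cast_nonneg k : (0 : ℝ) ≤ k)]
        _ = _ := by ring
  have hle := tsum_of_norm_bounded (hasSum_geometric_two.mul_left (1 / 20)) hb
  rw [ht.tsum_eq, Real.norm_eq_abs, abs_le] at hle
  norm_num [Finset.sum_range_succ, coeffJ0, Nat.factorial] at hle
  linarith [hle.2]

lemma J0_c0 : J0 c0 = 0 := by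
  have hset : {x : ℝ | 0 < x ∧ J0 x = 0} = {x : ℝ | 0 ≤ x ∧ J0 x = 0} := by
    ext x
    refine ⟨fun h => ⟨h.1.le, h.2⟩, fun h => ⟨h.1.lt_of_ne ?_, h.2⟩⟩
    rintro rfl
    exact one_ne_zero (J0_zero.symm.trans h.2)
  have hclosed : IsClosed {x : ℝ | 0 ≤ x ∧ J0 x = 0} :=
    (isClosed_le continuous_const continuous_id).inter
      (isClosed_eq continuous_J0 continuous_const)
  have hne : {x : ℝ | 0 ≤ x ∧ J0 x = 0}.Nonempty := by
    obtain ⟨x, hx, hx0⟩ := intermediate_value_Icc' (by norm_num : (0 : ℝ) ≤ 3)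
      continuous_J0.continuousOn ⟨J0_three_neg.le, by rw [J0_zero]; norm_num⟩
    exact ⟨x, hx.1, hx0⟩
  have := hclosed.csInf_mem hne ⟨0, fun x hx => hx.1⟩
  rw [← hset] at this
  exact this.2

lemma integral_J1 (x : ℝ) : ∫ t in (0 : ℝ)..x, J1 t = 1 - J0 x := by
  have h := intervalIntegral.hasSum_integral_of_dominated_convergence (a := 0) (b := x)
    (μ := volume) (F := fun k t => t * (coeffJ1 k * t ^ (2 * k))) (f := J1)
    (fun k _ => |x| * ((|x| ^ 2) ^ k / (Nat.factorial k : ℝ)))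
    (fun k => by fun_prop)
    (fun k => Filter.Eventually.of_forall fun t ht => by
      have ht' : |t| ≤ |x| := by
        simpa using Set.abs_sub_left_of_mem_uIcc (Set.uIoc_subset_uIcc ht)
      rw [norm_mul, Real.norm_eq_abs t]
      gcongr
      exact norm_term_le abs_coeffJ1_le ht' k)
    (Filter.Eventually.of_forall fun t _ =>
      (Real.summable_pow_div_factorial (|x| ^ 2)).mul_left |x|)
    (by simp)
    (Filter.Eventually.of_forall fun t _ => by
      rw [J1_eq]
      exact (hasSum_evenSeries abs_coeffJ1_le t).mul_left t)
  have h0 := (hasSum_nat_add_iff' 1).2 (hasSum_evenSeries abs_coeffJ0_le x)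
  rw [← J0_eq] at h0
  have hterm : ∀ k, ∫ t in (0 : ℝ)..x, t * (coeffJ1 k * t ^ (2 * k)) =
      -(coeffJ0 (k + 1) * x ^ (2 * (k + 1))) := by
    intro k
    rw [show (fun t : ℝ => t * (coeffJ1 k * t ^ (2 * k))) =
        fun t => coeffJ1 k * t ^ (2 * k + 1) by ext t; ring,
      intervalIntegral.integral_const_mul, integral_pow, coeffJ0, coeffJ1, Nat.factorial_succ]
    push_cast
    field_simp
    ring
  simp only [hterm] at h
  rw [h.unique h0.neg]
  simp [coeffJ0]

lemma integral_pow_mul_sub_pow (z : ℝ) (m n : ℕ) :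
    ∫ t in (0 : ℝ)..z, t ^ m * (z - t) ^ n =
      (m.factorial : ℝ) * n.factorial / (m + n + 1).factorial * z ^ (m + n + 1) := by
  induction n generalizing m with
  | zero =>
    simp [integral_pow, Nat.factorial_succ]
    field_simp
  | succ n ih =>
    have hd : ∀ t ∈ Set.uIcc 0 z, HasDerivAt (fun t : ℝ => t ^ (m + 1) * (z - t) ^ (n + 1))
        ((m + 1) * (t ^ m * (z - t) ^ (n + 1)) - (n + 1) * (t ^ (m + 1) * (z - t) ^ n)) t := by
      intro t _
      refine ((hasDerivAt_pow (m + 1) t).mul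
        (((hasDerivAt_id t).const_sub z).pow (n + 1))).congr_deriv ?_
      simp
      ring
    have hi := intervalIntegral.integral_eq_sub_of_hasDerivAt hd
      (Continuous.intervalIntegrable (by fun_prop) _ _)
    rw [intervalIntegral.integral_sub (Continuous.intervalIntegrable (by fun_prop) _ _)
      (Continuous.intervalIntegrable (by fun_prop) _ _), intervalIntegral.integral_const_mul,
      intervalIntegral.integral_const_mul, ih] at hi
    have hm : (m + 1 : ℝ) ≠ 0 := by positivity
    apply mul_left_cancel₀ hm
    simp at hi
    rw [sub_eq_zero.1 hi, show m + 1 + n + 1 = m + (n + 1) + 1 by ring,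
      Nat.factorial_succ m, Nat.factorial_succ n]
    push_cast
    ring

lemma sum_catalan_mul_centralBinom (n : ℕ) :
    2 * ∑ p ∈ Finset.HasAntidiagonal.antidiagonal n, catalan p.1 * Nat.centralBinom p.2 =
      Nat.centralBinom (n + 1) := by
  have h1 : ∑ p ∈ Finset.HasAntidiagonal.antidiagonal n, catalan p.1 * Nat.centralBinom p.2 =
      ∑ p ∈ Finset.HasAntidiagonal.antidiagonal n, (p.2 + 1) * (catalan p.1 * catalan p.2) :=
    Finset.sum_congr rfl fun p _ => by rw [← succ_mul_catalan_eq_centralBinom]; ring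
  have h2 : ∑ p ∈ Finset.HasAntidiagonal.antidiagonal n, (p.2 + 1) * (catalan p.1 * catalan p.2) =
      ∑ p ∈ Finset.HasAntidiagonal.antidiagonal n,
        (p.1 + 1) * (catalan p.1 * catalan p.2) := by
    rw [← Finset.Nat.sum_antidiagonal_swap]
    exact Finset.sum_congr rfl fun p _ => by simp only [Prod.fst_swap, Prod.snd_swap]; ring
  calc 2 * ∑ p ∈ Finset.HasAntidiagonal.antidiagonal n, catalan p.1 * Nat.centralBinom p.2
      = ∑ p ∈ Finset.HasAntidiagonal.antidiagonal n, (p.1 + 1) * (catalan p.1 * catalan p.2) +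
        ∑ p ∈ Finset.HasAntidiagonal.antidiagonal n, (p.2 + 1) * (catalan p.1 * catalan p.2) := by
          rw [h1, ← h2]; ring
    _ = (n + 2) * ∑ p ∈ Finset.HasAntidiagonal.antidiagonal n, catalan p.1 * catalan p.2 := by
      rw [← Finset.sum_add_distrib, Finset.mul_sum]
      refine Finset.sum_congr rfl fun p hp => ?_
      rw [← Finset.HasAntidiagonal.mem_antidiagonal.1 hp]
      ring
    _ = Nat.centralBinom (n + 1) := by
      rw [← catalan_succ', ← succ_mul_catalan_eq_centralBinom]

lemma centralBinom_cast (n : ℕ) :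
    (Nat.centralBinom n : ℝ) = ((2 * n).factorial : ℝ) / (n.factorial : ℝ) ^ 2 := by
  rw [Nat.centralBinom, Nat.cast_choose ℝ (by omega), show 2 * n - n = n by omega, sq]

lemma catalan_cast (n : ℕ) :
    (catalan n : ℝ) = ((2 * n).factorial : ℝ) / ((n.factorial : ℝ) * ((n + 1).factorial : ℝ)) := by
  have h : ((n + 1 : ℝ)) * catalan n = Nat.centralBinom n := by
    exact_mod_cast succ_mul_catalan_eq_centralBinom n
  rw [centralBinom_cast] at h
  have h1 : (n + 1 : ℝ) ≠ 0 := by positivity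
  apply mul_left_cancel₀ h1
  rw [h, Nat.factorial_succ]
  push_cast
  field_simp

lemma sum_antidiagonal_coeff (n : ℕ) :
    ∑ p ∈ Finset.HasAntidiagonal.antidiagonal n, coeffJ1 p.1 * coeffJ0 p.2 *
      (((2 * p.1).factorial : ℝ) * (2 * p.2).factorial / (2 * p.1 + 2 * p.2 + 1).factorial) =
      coeffJ1 n := by
  have h : ∀ p ∈ Finset.HasAntidiagonal.antidiagonal n, coeffJ1 p.1 * coeffJ0 p.2 *
      (((2 * p.1).factorial : ℝ) * (2 * p.2).factorial / (2 * p.1 + 2 * p.2 + 1).factorial) =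
      (-1) ^ n / (2 * 4 ^ n * (2 * n + 1).factorial) *
        ((catalan p.1 : ℝ) * Nat.centralBinom p.2) := by
    intro p hp
    rw [← Finset.HasAntidiagonal.mem_antidiagonal.1 hp, coeffJ1, coeffJ0, catalan_cast,
      centralBinom_cast, pow_add, pow_add, mul_add]
    field_simp
  rw [Finset.sum_congr rfl h, ← Finset.mul_sum]
  have hs : (2 : ℝ) * ∑ p ∈ Finset.HasAntidiagonal.antidiagonal n,
      (catalan p.1 : ℝ) * Nat.centralBinom p.2 = Nat.centralBinom (n + 1) := by
    exact_mod_cast sum_catalan_mul_centralBinom n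
  rw [centralBinom_cast, show 2 * (n + 1) = 2 * n + 1 + 1 by ring,
    Nat.factorial_succ (2 * n + 1)] at hs
  rw [eq_div_of_mul_eq (by norm_num) ((mul_comm _ _).trans hs), coeffJ1, Nat.factorial_succ n]
  push_cast
  field_simp
  ring

lemma hasSum_antidiagonal {f : ℕ × ℕ → ℝ} {s : ℝ} (hf : HasSum f s) :
    HasSum (fun n => ∑ p ∈ Finset.HasAntidiagonal.antidiagonal n, f p) s := by
  refine ((Finset.HasAntidiagonal.sigmaAntidiagonalEquivProd.hasSum_iff.2 hf).sigma
    fun n => hasSum_fintype _).congr_fun fun n => ?_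
  exact (Finset.sum_coe_sort _ f).symm

/-- The convolution of `J₁(t) / t` with `J₀` on `[0, z]` is `J₁(z)`. -/
lemma integral_conv (z : ℝ) :
    ∫ t in (0 : ℝ)..z, evenSeries coeffJ1 t * J0 (z - t) = J1 z := by
  have hsum : Summable fun p : ℕ × ℕ => (|z| ^ 2) ^ p.1 / (Nat.factorial p.1 : ℝ) *
      ((|z| ^ 2) ^ p.2 / (Nat.factorial p.2 : ℝ)) :=
    (Real.summable_pow_div_factorial _).mul_of_nonneg (Real.summable_pow_div_factorial _)
      (fun _ => by positivity) (fun _ => by positivity)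
  have h := intervalIntegral.hasSum_integral_of_dominated_convergence (a := 0) (b := z)
    (μ := volume)
    (F := fun (p : ℕ × ℕ) t => (coeffJ1 p.1 * t ^ (2 * p.1)) * (coeffJ0 p.2 * (z - t) ^ (2 * p.2)))
    (f := fun t => evenSeries coeffJ1 t * J0 (z - t))
    (fun p _ => (|z| ^ 2) ^ p.1 / (Nat.factorial p.1 : ℝ) *
      ((|z| ^ 2) ^ p.2 / (Nat.factorial p.2 : ℝ)))
    (fun p => Continuous.aestronglyMeasurable (by fun_prop))
    (fun p => Filter.Eventually.of_forall fun t ht => by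
      have ht1 : |t| ≤ |z| := by
        simpa using Set.abs_sub_left_of_mem_uIcc (Set.uIoc_subset_uIcc ht)
      have ht2 : |z - t| ≤ |z| := by
        simpa using Set.abs_sub_right_of_mem_uIcc (Set.uIoc_subset_uIcc ht)
      rw [norm_mul]
      gcongr
      · exact norm_term_le abs_coeffJ1_le ht1 _
      · exact norm_term_le abs_coeffJ0_le ht2 _)
    (Filter.Eventually.of_forall fun t _ => hsum)
    (by simp)
    (Filter.Eventually.of_forall fun t _ => by
      rw [J0_eq]
      exact hasSum_mul_evenSeries abs_coeffJ1_le abs_coeffJ0_le t (z - t))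
  rw [J1_eq]
  refine (hasSum_antidiagonal h).unique
    (((hasSum_evenSeries abs_coeffJ1_le z).mul_left z).congr_fun fun n => ?_)
  rw [← sum_antidiagonal_coeff, Finset.sum_mul, Finset.mul_sum]
  refine Finset.sum_congr rfl fun p hp => ?_
  rw [show (fun t : ℝ => coeffJ1 p.1 * t ^ (2 * p.1) * (coeffJ0 p.2 * (z - t) ^ (2 * p.2))) =
      fun t => coeffJ1 p.1 * coeffJ0 p.2 * (t ^ (2 * p.1) * (z - t) ^ (2 * p.2)) by ext t; ring,
    intervalIntegral.integral_const_mul, integral_pow_mul_sub_pow,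
    ← Finset.HasAntidiagonal.mem_antidiagonal.1 hp]
  ring

lemma two_mul_F (α : ℝ) :
    2 * F α = c0 / Real.pi * (c0 / Real.pi * evenSeries coeffJ1 (c0 / Real.pi * α)) := by
  have hpi := Real.pi_ne_zero
  unfold F
  split_ifs with h
  · have h0 : evenSeries coeffJ1 0 = 1 / 2 := by
      rw [evenSeries, tsum_eq_single 0]
      · simp [coeffJ1]
      · intro k hk
        simp [hk]
    rw [h, mul_zero, h0]
    field_simp
  · rw [J1_eq, show α * c0 / Real.pi = c0 / Real.pi * α by ring]
    field_simp

lemma Finf_eq (β : ℝ) : Finf β = J0 (c0 / Real.pi * β) := by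
  rw [Finf, show β * c0 / Real.pi = c0 / Real.pi * β by ring]

lemma continuous_two_mul_F : Continuous fun α => 2 * F α := by
  rw [funext two_mul_F]
  have := continuous_evenSeries abs_coeffJ1_le
  fun_prop

lemma continuous_Finf : Continuous Finf := by
  rw [funext Finf_eq]
  have := continuous_J0
  fun_prop

lemma integral_F_mul_Finf (s : ℝ) :
    ∫ α in (0 : ℝ)..s, 2 * F α * Finf (s - α) = c0 / Real.pi * J1 (c0 / Real.pi * s) := by
  set a := c0 / Real.pi with ha
  rw [show (fun α => 2 * F α * Finf (s - α)) = fun α => a * (a *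
      (fun t => evenSeries coeffJ1 t * J0 (a * s - t)) (a * α)) by
    ext α
    rw [two_mul_F, Finf_eq, ← ha, mul_sub]
    ring, intervalIntegral.integral_const_mul, intervalIntegral.integral_const_mul,
    intervalIntegral.mul_integral_comp_mul_left
      (f := fun t => evenSeries coeffJ1 t * J0 (a * s - t)), mul_zero, integral_conv]

lemma integral_J1_scaled (θ : ℝ) :
    ∫ s in θ..Real.pi, c0 / Real.pi * J1 (c0 / Real.pi * s) = Finf θ := by
  rw [intervalIntegral.integral_const_mul, intervalIntegral.mul_integral_comp_mul_left,
    ← intervalIntegral.integral_interval_sub_left (a := 0)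
      (continuous_J1.intervalIntegrable _ _) (continuous_J1.intervalIntegrable _ _),
    integral_J1, integral_J1, div_mul_cancel₀ _ Real.pi_ne_zero, J0_c0, Finf_eq]
  ring

/-- Change of variables `s = α + β` followed by exchange of the order of integration. -/
lemma integral_strip {f g : ℝ → ℝ} (hf : Continuous f) (hg : Continuous g) {θ L : ℝ}
    (hθ0 : 0 ≤ θ) (hθL : θ ≤ L) :
    (∫ α in (0 : ℝ)..L, ∫ β in (0 : ℝ)..L,
      if θ < α + β ∧ α + β < L then f α * g β else 0) =
      ∫ s in θ..L, ∫ α in (0 : ℝ)..s, f α * g (s - α) := by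
  have hL : 0 ≤ L := hθ0.trans hθL
  have hinner : ∀ α ∈ Set.Ioc 0 L, (∫ β in (0 : ℝ)..L,
      if θ < α + β ∧ α + β < L then f α * g β else 0) =
      ∫ s in Set.Ioo θ L, if α < s then f α * g (s - α) else 0 := by
    intro α hα
    rw [intervalIntegral.integral_of_le hL, ← integral_indicator measurableSet_Ioc,
      ← integral_indicator measurableSet_Ioo, ← integral_sub_right_eq_self _ α]
    congr 1 with s
    simp only [Set.indicator_apply, Set.mem_Ioc, Set.mem_Ioo, add_sub_cancel]
    split_ifs <;> first | rfl | (exfalso; grind)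
  rw [intervalIntegral.integral_of_le hL, setIntegral_congr_fun measurableSet_Ioc hinner,
    integral_integral_swap, intervalIntegral.integral_of_le hθL, integral_Ioc_eq_integral_Ioo]
  · refine setIntegral_congr_fun measurableSet_Ioo fun s hs => ?_
    have hs0 : 0 ≤ s := hθ0.trans hs.1.le
    rw [intervalIntegral.integral_of_le hs0, integral_Ioc_eq_integral_Ioo (x := 0) (y := s),
      ← integral_indicator measurableSet_Ioc, ← integral_indicator measurableSet_Ioo]
    congr 1 with α
    simp only [Set.indicator_apply, Set.mem_Ioc, Set.mem_Ioo]
    have := hs.2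
    split_ifs <;> first | rfl | (exfalso; grind)
  · have hcont : Continuous fun p : ℝ × ℝ => f p.1 * g (p.2 - p.1) := by fun_prop
    have hint : Integrable (fun p : ℝ × ℝ => f p.1 * g (p.2 - p.1))
        ((volume.restrict (Set.Ioc 0 L)).prod (volume.restrict (Set.Ioo θ L))) := by
      rw [Measure.prod_restrict]
      exact (hcont.continuousOn.integrableOn_compact (isCompact_Icc.prod isCompact_Icc)).mono_set
        (Set.prod_mono Set.Ioc_subset_Icc_self Set.Ioo_subset_Icc_self)
    refine (hint.indicator (measurableSet_lt measurable_fst measurable_snd)).congr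
      (Filter.Eventually.of_forall fun p => ?_)
    simp [Set.indicator_apply, Function.uncurry]

/-- Equation (eq:Finftyintegral), the criticality identity: for every `θ ∈ [0,π]`,
`∫₀^π ∫₀^π 1{θ < α+β < π} · 2 F(α) F_∞(β) dα dβ = F_∞(θ)`. -/
theorem criticality_identity (θ : ℝ) (hθ0 : 0 ≤ θ) (hθπ : θ ≤ Real.pi) :
    (∫ α in (0:ℝ)..Real.pi, ∫ β in (0:ℝ)..Real.pi,
      if θ < α + β ∧ α + β < Real.pi then 2 * F α * Finf β else 0) = Finf θ := by
  rw [integral_strip continuous_two_mul_F continuous_Finf hθ0 hθπ]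
  simp only [integral_F_mul_Finf]
  exact integral_J1_scaled θ
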